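/- For all integers m ≥ 2, n ≥ 1 and 0 ≤ d ≤ ⌊(n−1)/2⌋, the counting function 𝔭_{m,n}(d) := #APS_d(m,n) satisfies the recursion 𝔭_{m,n}(d) = Σ_{i=0}^{d} C(n,i) · 𝔭_{m−1, n−i}(d−i); moreover 𝔭_{1,n}(d) = C(n−1, d) for 0 ≤ d ≤ ⌊(n−1)/2⌋, and 𝔭_{m,n}(0) = 1 for all m, n ≥ 1. -/

import Mathlib

open Finset

/-- `Prec p q` means the colored symbol `p = ξ^{p.1}(p.2)` precedes (is smaller than)
`q = ξ^{q.1}(q.2)`: `a > b`, or (`a = b` and `x > y`). -/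
def Prec (p q : ℕ × ℕ) : Prop :=
  q.1 < p.1 ∨ (p.1 = q.1 ∧ q.2 < p.2)

instance : DecidableRel Prec := fun p q => by
  unfold Prec; infer_instance

/-- `w : ℕ → ℕ × ℕ` (read on positions `1,…,n`) is an element of `Z_m ≀ S_n`:
each entry has color `< m` and norm in `{1,…,n}`, and the norms are pairwise distinct. -/
def IsGenPerm (m n : ℕ) (w : ℕ → ℕ × ℕ) : Prop :=
  (∀ i ∈ Finset.Icc 1 n, (w i).1 < m ∧ (w i).2 ∈ Finset.Icc 1 n) ∧
    Set.InjOn (fun i => (w i).2) (Set.Icc 1 n)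

/-- The pinnacle set of the word `w`: values at interior positions `2 ≤ i ≤ n-1`
that strictly dominate both neighbors. -/
def pin (n : ℕ) (w : ℕ → ℕ × ℕ) : Finset (ℕ × ℕ) :=
  ((Finset.Icc 2 (n - 1)).filter
      (fun i => Prec (w (i - 1)) (w i) ∧ Prec (w (i + 1)) (w i))).image w

/-- `P` is an admissible pinnacle set for `Z_m ≀ S_n`. -/
def IsAdmissible (m n : ℕ) (P : Finset (ℕ × ℕ)) : Prop :=
  ∃ w, IsGenPerm m n w ∧ pin n w = P

/-- `APS m n d` : admissible pinnacle sets for `Z_m ≀ S_n` of cardinality at most `d`. -/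
def APS (m n d : ℕ) : Set (Finset (ℕ × ℕ)) :=
  {P | IsAdmissible m n P ∧ P.card ≤ d}

lemma Prec.asymm {p q : ℕ × ℕ} (h : Prec p q) : ¬ Prec q p := by
  unfold Prec at *; omega

lemma Prec.trans {p q r : ℕ × ℕ} (h : Prec p q) (h' : Prec q r) : Prec p r := by
  unfold Prec at *; omega

/-- A set `P` of symbols with colors `≤ c` and distinct norms in `G` such that every `p ∈ P`
strictly dominates more free norms (given the least color `c`) than there are elements of `P`
weakly below it. -/
def IsBallot (c : ℕ) (G : Finset ℕ) (P : Finset (ℕ × ℕ)) : Prop :=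
  (∀ p ∈ P, p.1 ≤ c ∧ p.2 ∈ G) ∧ Set.InjOn Prod.snd (P : Set (ℕ × ℕ)) ∧
    ∀ p ∈ P, #{q ∈ P | ¬ Prec p q} < #{y ∈ G | y ∉ P.image Prod.snd ∧ Prec (c, y) p}

lemma exists_prec_enumeration (S : Finset (ℕ × ℕ)) :
    ∃ e : ℕ → ℕ × ℕ, (∀ i, 1 ≤ i → i ≤ #S → e i ∈ S) ∧
      (∀ i j, 1 ≤ i → i < j → j ≤ #S → Prec (e i) (e j)) ∧
      ∀ s ∈ S, ∃ i, 1 ≤ i ∧ i ≤ #S ∧ e i = s := by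
  let κ : ℕ × ℕ ≃ (ℕ ×ₗ ℕ)ᵒᵈ := toLex.trans OrderDual.toDual
  have hκ : ∀ p q, κ p < κ q ↔ Prec p q := by
    intro p q
    change toLex q < toLex p ↔ _
    rw [Prod.Lex.toLex_lt_toLex]
    unfold Prec
    omega
  let T := S.map κ.toEmbedding
  have hT : #T = #S := card_map _
  let f := T.orderEmbOfFin hT
  have hf : ∀ i (h : i - 1 < #S), κ.symm (f ⟨i - 1, h⟩) ∈ S := by
    intro i h
    have := T.orderEmbOfFin_mem hT ⟨i - 1, h⟩
    simpa [T, f] using this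
  refine ⟨fun i => if h : i - 1 < #S then κ.symm (f ⟨i - 1, h⟩) else 0, ?_, ?_, ?_⟩
  · intro i h1 h2
    have h : i - 1 < #S := by omega
    simp only [h, dif_pos]
    exact hf i h
  · intro i j h1 h2 h3
    have h : i - 1 < #S := by omega
    have h' : j - 1 < #S := by omega
    simp only [h, h', dif_pos]
    rw [← hκ]
    simp only [Equiv.apply_symm_apply]
    apply f.strictMono
    simp only [Fin.mk_lt_mk]
    omega
  · intro s hs
    have hs' : κ s ∈ Set.range f := by
      rw [Finset.range_orderEmbOfFin]
      simpa [T] using hs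
    obtain ⟨i, hi⟩ := hs'
    refine ⟨i + 1, by omega, i.2, ?_⟩
    simp [hi]

lemma IsBallot.two_mul_card_lt {c : ℕ} {G : Finset ℕ} {P : Finset (ℕ × ℕ)}
    (h : IsBallot c G P) (hG : G.Nonempty) : 2 * #P < #G := by
  obtain ⟨h1, h2, h3⟩ := h
  rcases P.eq_empty_or_nonempty with rfl | hP
  · simpa using hG
  obtain ⟨e, e1, e2, e3⟩ := exists_prec_enumeration P
  have hk : 1 ≤ #P := hP.card_pos
  have hp := e1 #P hk le_rfl
  have := h3 _ hp
  rw [filter_true_of_mem] at this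
  · have hle : #{y ∈ G | y ∉ P.image Prod.snd ∧ Prec (c, y) (e #P)} ≤ #(G \ P.image Prod.snd) := by
      apply card_le_card
      intro y
      simp only [mem_filter, mem_sdiff]
      tauto
    rw [card_sdiff_of_subset, card_image_of_injOn h2] at hle
    · omega
    · intro y hy
      obtain ⟨p, hp, rfl⟩ := mem_image.1 hy
      exact (h1 p hp).2
  · intro q hq
    obtain ⟨i, hi1, hi2, rfl⟩ := e3 q hq
    rcases hi2.lt_or_eq with hlt | heq
    · exact (e2 _ _ hi1 hlt le_rfl).asymm
    · rw [heq]; unfold Prec; omega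

lemma isBallot_pin {c n : ℕ} {w : ℕ → ℕ × ℕ} (hw : IsGenPerm (c + 1) n w) :
    IsBallot c (Icc 1 n) (pin n w) := by
  obtain ⟨hmem, hinj⟩ := hw
  have hpin : ∀ p, p ∈ pin n w ↔ ∃ i, (2 ≤ i ∧ i ≤ n - 1) ∧
      (Prec (w (i - 1)) (w i) ∧ Prec (w (i + 1)) (w i)) ∧ w i = p := by
    intro p
    simp [pin, and_assoc]
  have hpos : ∀ i j, 1 ≤ i → i ≤ n → 1 ≤ j → j ≤ n → (w i).2 = (w j).2 → i = j :=
    fun i j h1 h2 h3 h4 h => hinj ⟨h1, h2⟩ ⟨h3, h4⟩ h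
  refine ⟨?_, ?_, ?_⟩
  · intro p hp
    obtain ⟨i, hi, -, rfl⟩ := (hpin p).1 hp
    have := hmem i (mem_Icc.2 (by omega))
    exact ⟨by omega, this.2⟩
  · intro p hp q hq hpq
    obtain ⟨i, hi, -, rfl⟩ := (hpin p).1 hp
    obtain ⟨j, hj, -, rfl⟩ := (hpin q).1 hq
    rw [hpos i j (by omega) (by omega) (by omega) (by omega) hpq]
  · intro p hp
    set S := {i ∈ Icc 2 (n - 1) | (Prec (w (i - 1)) (w i) ∧ Prec (w (i + 1)) (w i)) ∧
      ¬ Prec p (w i)} with hS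
    have hSm : ∀ i, i ∈ S ↔ (2 ≤ i ∧ i ≤ n - 1) ∧
        (Prec (w (i - 1)) (w i) ∧ Prec (w (i + 1)) (w i)) ∧ ¬ Prec p (w i) := by
      intro i
      simp [hS]
    have hle : #{q ∈ pin n w | ¬ Prec p q} ≤ #S := by
      refine (card_le_card ?_).trans (card_image_le (s := S) (f := w))
      intro q hq
      rw [mem_filter, hpin] at hq
      obtain ⟨⟨i, hi, hpk, rfl⟩, hq⟩ := hq
      exact mem_image_of_mem w ((hSm i).2 ⟨hi, hpk, hq⟩)
    have hSne : S.Nonempty := by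
      obtain ⟨i, hi, hpk, rfl⟩ := (hpin p).1 hp
      exact ⟨i, (hSm i).2 ⟨hi, hpk, by unfold Prec; omega⟩⟩
    set T := insert (S.max' hSne + 1) (S.image (· - 1)) with hT
    have hTm : ∀ t ∈ T, ∃ i ∈ S, t = i - 1 ∨ t = i + 1 := by
      intro t ht
      rcases mem_insert.1 ht with rfl | ht
      · exact ⟨_, S.max'_mem hSne, Or.inr rfl⟩
      · obtain ⟨i, hi, rfl⟩ := mem_image.1 ht
        exact ⟨i, hi, Or.inl rfl⟩
    have hTcard : #T = #S + 1 := by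
      rw [hT, card_insert_of_notMem, card_image_of_injOn]
      · intro i hi j hj hij
        have := ((hSm i).1 hi).1
        have := ((hSm j).1 hj).1
        simp only at hij
        omega
      · intro h
        obtain ⟨i, hi, h⟩ := mem_image.1 h
        have := S.le_max' i hi
        omega
    have hTle : #T ≤ #{y ∈ Icc 1 n | y ∉ (pin n w).image Prod.snd ∧ Prec (c, y) p} := by
      rw [← card_image_of_injOn (s := T) (f := fun t => (w t).2)]
      · apply card_le_card
        intro y hy
        obtain ⟨t, ht, rfl⟩ := mem_image.1 hy
        obtain ⟨i, hi, hti⟩ := hTm t ht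
        obtain ⟨hi1, hi2, hi3⟩ := (hSm i).1 hi
        have htn : 1 ≤ t ∧ t ≤ n := by omega
        have hlt : Prec (w t) (w i) := by
          rcases hti with rfl | rfl
          exacts [hi2.1, hi2.2]
        have hwt := hmem t (mem_Icc.2 htn)
        refine mem_filter.2 ⟨hwt.2, ?_, ?_⟩
        · intro h
          obtain ⟨q, hq, hqt⟩ := mem_image.1 h
          obtain ⟨j, hj, hpk, rfl⟩ := (hpin q).1 hq
          obtain rfl := hpos j t (by omega) (by omega) htn.1 htn.2 hqt
          apply hlt.asymm
          rcases hti with rfl | rfl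
          · have := hpk.2
            rwa [Nat.sub_add_cancel (by omega)] at this
          · exact hpk.1
        · unfold Prec at *
          simp only
          omega
      · intro t ht t' ht' htt
        obtain ⟨i, hi, hti⟩ := hTm t ht
        obtain ⟨i', hi', hti'⟩ := hTm t' ht'
        have := ((hSm i).1 hi).1
        have := ((hSm i').1 hi').1
        exact hpos t t' (by omega) (by omega) (by omega) (by omega) htt
    omega

lemma IsBallot.isAdmissible {c n : ℕ} {P : Finset (ℕ × ℕ)} (hn : 1 ≤ n)
    (h : IsBallot c (Icc 1 n) P) : IsAdmissible (c + 1) n P := by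
  have hcard := h.two_mul_card_lt ⟨1, by simpa using hn⟩
  obtain ⟨h1, h2, h3⟩ := h
  rw [Nat.card_Icc] at hcard
  set Q : Finset (ℕ × ℕ) := (Icc 1 n \ P.image Prod.snd).image (fun y => (c, y)) with hQ
  have hQm : ∀ q, q ∈ Q ↔ q.1 = c ∧ (1 ≤ q.2 ∧ q.2 ≤ n) ∧ q.2 ∉ P.image Prod.snd := by
    rintro ⟨a, x⟩
    simp only [hQ, Finset.mem_image, mem_sdiff, mem_Icc, Prod.mk.injEq]
    constructor
    · rintro ⟨y, hy, rfl, rfl⟩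
      exact ⟨rfl, hy⟩
    · rintro ⟨rfl, hy⟩
      exact ⟨x, hy, rfl, rfl⟩
  have hQcard : #Q + #P = n := by
    have hsub : P.image Prod.snd ⊆ Icc 1 n := by
      intro y hy
      obtain ⟨p, hp, rfl⟩ := mem_image.1 hy
      exact (h1 p hp).2
    have := card_le_card hsub
    rw [card_image_of_injOn h2, Nat.card_Icc] at this
    rw [hQ, card_image_of_injective _ (Prod.mk_right_injective c), card_sdiff_of_subset hsub,
      card_image_of_injOn h2, Nat.card_Icc]
    omega
  obtain ⟨p, p1, p2, p3⟩ := exists_prec_enumeration P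
  obtain ⟨q, q1, q2, q3⟩ := exists_prec_enumeration Q
  set k := #P with hk
  have hqp : ∀ j, 1 ≤ j → j ≤ k → Prec (q (j + 1)) (p j) := by
    intro j hj hjk
    by_contra hcon
    have hlow : j ≤ #{r ∈ P | ¬ Prec (p j) r} := by
      have hinj : Set.InjOn p (Icc 1 j : Finset ℕ) := by
        intro a ha b hb hab
        simp only [coe_Icc, Set.mem_Icc] at ha hb
        by_contra hne
        rcases Nat.lt_or_gt_of_ne hne with hlt | hlt
        · have := p2 a b ha.1 hlt (by omega)
          rw [hab] at this
          exact this.asymm this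
        · have := p2 b a hb.1 hlt (by omega)
          rw [hab] at this
          exact this.asymm this
      calc j = #((Icc 1 j).image p) := by rw [card_image_of_injOn hinj, Nat.card_Icc]; omega
        _ ≤ _ := by
          apply card_le_card
          intro r hr
          obtain ⟨a, ha, rfl⟩ := mem_image.1 hr
          rw [mem_Icc] at ha
          refine mem_filter.2 ⟨p1 a ha.1 (by omega), ?_⟩
          rcases ha.2.lt_or_eq with hlt | rfl
          · exact (p2 a j ha.1 hlt hjk).asymm
          · exact fun h => h.asymm h
    have hup : #{y ∈ Icc 1 n | y ∉ P.image Prod.snd ∧ Prec (c, y) (p j)} ≤ j := by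
      calc _ ≤ #((Icc 1 j).image fun i => (q i).2) := by
            apply card_le_card
            intro y hy
            rw [mem_filter, mem_Icc] at hy
            obtain ⟨i, hi1, hi2, hi⟩ := q3 (c, y) ((hQm _).2 ⟨rfl, hy.1, hy.2.1⟩)
            refine mem_image.2 ⟨i, mem_Icc.2 ⟨hi1, ?_⟩, by rw [hi]⟩
            by_contra hij
            apply hcon
            rw [← hi] at hy
            rcases (show j + 1 ≤ i by omega).lt_or_eq with hlt | heq
            · exact (q2 _ _ (by omega) hlt hi2).trans hy.2.2
            · rw [heq]; exact hy.2.2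
        _ ≤ #(Icc 1 j) := card_image_le
        _ = j := by rw [Nat.card_Icc]; omega
    have := h3 _ (p1 j hj hjk)
    omega
  let w : ℕ → ℕ × ℕ := fun i =>
    if 2 * k + 1 ≤ i then q (i - k) else if i % 2 = 0 then p (i / 2) else q ((i + 1) / 2)
  have hwp : ∀ j, j ≤ k → w (2 * j) = p j := by
    intro j hj
    simp only [w]
    rw [if_neg (by omega), if_pos (by omega)]
    congr 1; omega
  have hwq : ∀ j, j ≤ k → w (2 * j + 1) = q (j + 1) := by
    intro j hj
    simp only [w]
    split_ifs with h h'
    · congr 1; omega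
    · omega
    · congr 1; omega
  have hwt : ∀ i, 2 * k + 1 ≤ i → w i = q (i - k) := by
    intro i hi
    simp only [w]
    rw [if_pos hi]
  have hpos : ∀ i, 1 ≤ i → (∃ j, 1 ≤ j ∧ j ≤ k ∧ i = 2 * j) ∨ (∃ j, j ≤ k ∧ i = 2 * j + 1) ∨
      2 * k + 2 ≤ i := by
    intro i hi
    rcases Nat.even_or_odd' i with ⟨j, rfl | rfl⟩
    · by_cases hj : j ≤ k
      · exact Or.inl ⟨j, by omega, hj, rfl⟩
      · exact Or.inr (Or.inr (by omega))
    · by_cases hj : j ≤ k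
      · exact Or.inr (Or.inl ⟨j, hj, rfl⟩)
      · exact Or.inr (Or.inr (by omega))
  have hwmem : ∀ i, 1 ≤ i → i ≤ n → (w i).1 < c + 1 ∧ (w i).2 ∈ Icc 1 n := by
    have hp : ∀ j, 1 ≤ j → j ≤ k → (p j).1 < c + 1 ∧ (p j).2 ∈ Icc 1 n := by
      intro j hj hj'
      have := h1 _ (p1 j hj hj')
      exact ⟨by omega, this.2⟩
    have hq : ∀ j, 1 ≤ j → j ≤ #Q → (q j).1 < c + 1 ∧ (q j).2 ∈ Icc 1 n := by
      intro j hj hj'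
      have := (hQm _).1 (q1 j hj hj')
      exact ⟨by omega, mem_Icc.2 this.2.1⟩
    intro i hi hin
    rcases hpos i hi with ⟨j, hj, hjk, rfl⟩ | ⟨j, hjk, rfl⟩ | hi'
    · rw [hwp j hjk]; exact hp j hj hjk
    · rw [hwq j hjk]; exact hq _ (by omega) (by omega)
    · rw [hwt i (by omega)]; exact hq _ (by omega) (by omega)
  refine ⟨w, ⟨fun i hi => hwmem i (mem_Icc.1 hi).1 (mem_Icc.1 hi).2, ?_⟩, ?_⟩
  · rw [← coe_Icc]
    refine Finset.injOn_of_surjOn_of_card_le (t := Icc 1 n) _ ?_ ?_ le_rfl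
    · intro i hi
      simp only [coe_Icc, Set.mem_Icc] at hi
      simpa using (hwmem i hi.1 hi.2).2
    · intro y hy
      simp only [coe_Icc, Set.mem_Icc] at hy
      by_cases hyP : y ∈ P.image Prod.snd
      · obtain ⟨r, hr, rfl⟩ := mem_image.1 hyP
        obtain ⟨j, hj1, hj2, rfl⟩ := p3 r hr
        refine ⟨2 * j, ?_, ?_⟩
        · simp only [coe_Icc, Set.mem_Icc]; omega
        · simp only [hwp j hj2]
      · obtain ⟨j, hj1, hj2, hj⟩ := q3 (c, y) ((hQm _).2 ⟨rfl, hy, hyP⟩)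
        by_cases hjk : j ≤ k + 1
        · refine ⟨2 * (j - 1) + 1, ?_, ?_⟩
          · simp only [coe_Icc, Set.mem_Icc]; omega
          · simp only [hwq (j - 1) (by omega), Nat.sub_add_cancel hj1, hj]
        · refine ⟨j + k, ?_, ?_⟩
          · simp only [coe_Icc, Set.mem_Icc]; omega
          · simp only [hwt (j + k) (by omega), Nat.add_sub_cancel, hj]
  · ext r
    simp only [pin, Finset.mem_image, mem_filter, mem_Icc]
    constructor
    · rintro ⟨i, ⟨⟨hi2, hin⟩, hl, hr⟩, rfl⟩
      rcases hpos i (by omega) with ⟨j, hj, hjk, rfl⟩ | ⟨j, hjk, rfl⟩ | hi'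
      · rw [hwp j hjk]; exact p1 j hj hjk
      · rw [Nat.add_sub_cancel, hwp j hjk, hwq j hjk] at hl
        exact absurd (hqp j (by omega) hjk) hl.asymm
      · rw [hwt i (by omega), hwt (i + 1) (by omega)] at hr
        exact absurd (q2 (i - k) (i + 1 - k) (by omega) (by omega) (by omega)) hr.asymm
    · intro hr
      obtain ⟨j, hj, hjk, rfl⟩ := p3 r hr
      refine ⟨2 * j, ⟨⟨by omega, by omega⟩, ?_, ?_⟩, hwp j hjk⟩
      · have := hwq (j - 1) (by omega)
        rw [show 2 * (j - 1) + 1 = 2 * j - 1 by omega, Nat.sub_add_cancel hj] at this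
        rw [this, hwp j hjk]
        exact (q2 j (j + 1) hj (by omega) (by omega)).trans (hqp j hj hjk)
      · rw [hwq j hjk, hwp j hjk]
        exact hqp j hj hjk

lemma isAdmissible_iff_isBallot {c n : ℕ} (hn : 1 ≤ n) (P : Finset (ℕ × ℕ)) :
    IsAdmissible (c + 1) n P ↔ IsBallot c (Icc 1 n) P := by
  constructor
  · rintro ⟨w, hw, rfl⟩
    exact isBallot_pin hw
  · exact IsBallot.isAdmissible hn

lemma isBallot_empty (c : ℕ) (G : Finset ℕ) : IsBallot c G ∅ := by
  simp [IsBallot]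

open Classical in
/-- The ballot sets of cardinality at most `d`. -/
noncomputable def ballotSets (c : ℕ) (G : Finset ℕ) (d : ℕ) : Finset (Finset (ℕ × ℕ)) :=
  {P ∈ (range (c + 1) ×ˢ G).powerset | IsBallot c G P ∧ #P ≤ d}

lemma mem_ballotSets {c : ℕ} {G : Finset ℕ} {d : ℕ} {P : Finset (ℕ × ℕ)} :
    P ∈ ballotSets c G d ↔ IsBallot c G P ∧ #P ≤ d := by
  simp only [ballotSets, mem_filter, mem_powerset, and_iff_right_iff_imp]
  rintro ⟨h, -⟩ p hp
  have := h.1 p hp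
  exact mem_product.2 ⟨mem_range.2 (by omega), this.2⟩

lemma ballotSets_zero (c : ℕ) (G : Finset ℕ) : ballotSets c G 0 = {∅} := by
  ext P
  simp only [mem_ballotSets, Nat.le_zero, card_eq_zero, mem_singleton, and_iff_right_iff_imp]
  rintro rfl
  exact isBallot_empty c G

lemma APS_eq_ballotSets {c n : ℕ} (hn : 1 ≤ n) (d : ℕ) :
    APS (c + 1) n d = ballotSets c (Icc 1 n) d := by
  ext P
  simp only [APS, Set.mem_ofPred_eq, isAdmissible_iff_isBallot hn, mem_coe, mem_ballotSets]

/-! ### One color -/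

section OneColor

variable {a : ℕ} {G : Finset ℕ} {P : Finset (ℕ × ℕ)}

lemma isBallot_zero_insert (ha : ∀ x ∈ G, a < x) (haP : (0, a) ∉ P) :
    IsBallot 0 (insert a G) P ↔ IsBallot 0 G P := by
  have hmem : (∀ p ∈ P, p.1 ≤ 0 ∧ p.2 ∈ insert a G) ↔ ∀ p ∈ P, p.1 ≤ 0 ∧ p.2 ∈ G := by
    refine forall₂_congr fun p hp => and_congr_right fun h0 => ?_
    rw [mem_insert, or_iff_right]
    rintro rfl
    exact haP (by rwa [show (0, p.2) = p from Prod.ext (by simp only; omega) rfl])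
  unfold IsBallot
  rw [hmem]
  refine and_congr_right fun h1 => and_congr_right fun _ => forall₂_congr fun p hp => ?_
  rw [filter_insert, if_neg]
  have := ha _ (h1 p hp).2
  unfold Prec
  simp only
  omega

lemma isBallot_zero_insert_insert (ha : ∀ x ∈ G, a < x) (haP : (0, a) ∉ P)
    (hcard : 2 * (#P + 1) < #G + 1) :
    IsBallot 0 (insert a G) (insert (0, a) P) ↔ IsBallot 0 G P := by
  have haG : a ∉ G := fun h => (ha a h).false
  have key : (∀ p ∈ P, p.1 ≤ 0 ∧ p.2 ∈ G) → ∀ p ∈ P,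
      (#{q ∈ insert (0, a) P | ¬ Prec p q} <
        #{y ∈ insert a G | y ∉ (insert (0, a) P).image Prod.snd ∧ Prec (0, y) p} ↔
      #{q ∈ P | ¬ Prec p q} < #{y ∈ G | y ∉ P.image Prod.snd ∧ Prec (0, y) p}) := by
    intro h1 p hp
    rw [filter_insert, if_neg, filter_insert, if_neg]
    · rw [filter_congr (s := G) (q := fun y => y ∉ P.image Prod.snd ∧ Prec (0, y) p)]
      intro y hy
      have : y ≠ a := by rintro rfl; exact haG hy
      simp only [image_insert, mem_insert, this, false_or]
    · simp
    · have := ha _ (h1 p hp).2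
      have := (h1 p hp).1
      unfold Prec
      simp only
      omega
  constructor
  · rintro ⟨h1, h2, h3⟩
    have h1' : ∀ p ∈ P, p.1 ≤ 0 ∧ p.2 ∈ G := by
      intro p hp
      have h := h1 p (mem_insert_of_mem hp)
      refine ⟨h.1, (mem_insert.1 h.2).resolve_left ?_⟩
      rintro rfl
      have := h.1
      exact haP (by rwa [show (0, p.2) = p from Prod.ext (by simp only; omega) rfl])
    refine ⟨h1', h2.mono (by simp), fun p hp => ?_⟩
    exact (key h1' p hp).1 (h3 p (mem_insert_of_mem hp))
  · rintro ⟨h1, h2, h3⟩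
    have hsub : P.image Prod.snd ⊆ G := by
      intro y hy
      obtain ⟨p, hp, rfl⟩ := mem_image.1 hy
      exact (h1 p hp).2
    have haI : a ∉ P.image Prod.snd := fun h => haG (hsub h)
    refine ⟨?_, ?_, ?_⟩
    · intro p hp
      rcases mem_insert.1 hp with rfl | hp
      · simp
      · exact ⟨(h1 p hp).1, mem_insert_of_mem (h1 p hp).2⟩
    · rw [coe_insert, Set.injOn_insert (by simpa using haP)]
      refine ⟨h2, ?_⟩
      rw [← coe_image]
      exact haI
    · intro p hp
      rcases mem_insert.1 hp with rfl | hp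
      · have hle : #{q ∈ insert (0, a) P | ¬ Prec (0, a) q} ≤ #P + 1 :=
          (card_filter_le _ _).trans (card_insert_le _ _)
        have hge : #(G \ P.image Prod.snd) ≤
            #{y ∈ insert a G | y ∉ (insert (0, a) P).image Prod.snd ∧ Prec (0, y) (0, a)} := by
          apply card_le_card
          intro y hy
          rw [mem_sdiff] at hy
          have := ha y hy.1
          refine mem_filter.2 ⟨mem_insert_of_mem hy.1, ?_, Or.inr ⟨rfl, this⟩⟩
          rw [image_insert, mem_insert, not_or]
          exact ⟨this.ne', hy.2⟩
        rw [card_sdiff_of_subset hsub, card_image_of_injOn h2] at hge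
        omega
      · exact (key h1 p hp).2 (h3 p hp)

lemma IsBallot.zero_notMem (ha : ∀ x ∈ G, a < x) {c : ℕ} (h : IsBallot c G P) : (0, a) ∉ P :=
  fun hP => (ha a (h.1 _ hP).2).false

lemma card_ballotSets_zero_insert (ha : ∀ x ∈ G, a < x) {d : ℕ} (hd : 2 * (d + 1) < #G + 1) :
    #(ballotSets 0 (insert a G) (d + 1)) = #(ballotSets 0 G (d + 1)) + #(ballotSets 0 G d) := by
  have hunion : ballotSets 0 (insert a G) (d + 1) =
      ballotSets 0 G (d + 1) ∪ (ballotSets 0 G d).image (insert (0, a)) := by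
    ext P
    rw [mem_union, mem_image]
    constructor
    · intro hP
      rw [mem_ballotSets] at hP
      by_cases haP : (0, a) ∈ P
      · have hcard := card_erase_add_one haP
        refine Or.inr ⟨P.erase (0, a), ?_, insert_erase haP⟩
        rw [mem_ballotSets, ← isBallot_zero_insert_insert ha (notMem_erase _ _) (by omega),
          insert_erase haP]
        exact ⟨hP.1, by omega⟩
      · rw [isBallot_zero_insert ha haP] at hP
        exact Or.inl (mem_ballotSets.2 hP)
    · rintro (hP | ⟨P, hP, rfl⟩)
      · rw [mem_ballotSets] at hP
        rw [mem_ballotSets, isBallot_zero_insert ha (hP.1.zero_notMem ha)]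
        exact hP
      · rw [mem_ballotSets] at hP
        have haP := hP.1.zero_notMem ha
        rw [mem_ballotSets, isBallot_zero_insert_insert ha haP (by omega),
          card_insert_of_notMem haP]
        exact ⟨hP.1, by omega⟩
  rw [hunion, card_union_of_disjoint, card_image_of_injOn]
  · intro P hP Q hQ hPQ
    rw [← erase_insert ((mem_ballotSets.1 hP).1.zero_notMem ha),
      ← erase_insert ((mem_ballotSets.1 hQ).1.zero_notMem ha)]
    rw [hPQ]
  · rw [disjoint_left]
    intro P hP hP'
    obtain ⟨Q, -, rfl⟩ := mem_image.1 hP'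
    exact (mem_ballotSets.1 hP).1.zero_notMem ha (mem_insert_self _ _)

lemma card_ballotSets_zero (G : Finset ℕ) :
    ∀ d, G.Nonempty → d ≤ #G / 2 → #(ballotSets 0 G d) = (#G - 1).choose d := by
  induction G using Finset.induction_on_min with
  | empty => simp
  | insert a G ha ih =>
    have haG : a ∉ G := fun h => (ha a h).false
    intro d hne
    rw [card_insert_of_notMem haG, Nat.add_sub_cancel]
    induction d with
    | zero => simp [ballotSets_zero]
    | succ d ihd =>
      intro hd
      by_cases hlt : 2 * (d + 1) < #G + 1
      · have hG : G.Nonempty := card_pos.1 (by omega)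
        rw [card_ballotSets_zero_insert ha hlt, ih _ hG (by omega), ih _ hG (by omega)]
        obtain ⟨k, hk⟩ : ∃ k, #G = k + 1 := ⟨#G - 1, by have := hG.card_pos; omega⟩
        rw [hk, Nat.add_sub_cancel, Nat.choose_succ_succ, add_comm]
      · have heq : #G = 2 * d + 1 := by omega
        have hsets : ballotSets 0 (insert a G) (d + 1) = ballotSets 0 (insert a G) d := by
          ext P
          rw [mem_ballotSets, mem_ballotSets]
          refine and_congr_right fun h => ?_
          have := h.two_mul_card_lt hne
          rw [card_insert_of_notMem haG] at this
          omega
        rw [hsets, ihd (by omega), heq, Nat.choose_symm_half]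

end OneColor

/-! ### Removing the color `0` -/

/-- The set with color-`0` norms `A` and with the colors of `P` raised by one. -/
def glue (A : Finset ℕ) (P : Finset (ℕ × ℕ)) : Finset (ℕ × ℕ) :=
  A.image (fun x => (0, x)) ∪ P.image (fun p => (p.1 + 1, p.2))

/-- The norms of the color-`0` elements of `P`. -/
def topNorms (P : Finset (ℕ × ℕ)) : Finset ℕ :=
  {p ∈ P | p.1 = 0}.image Prod.snd

/-- The elements of `P` of nonzero color, with the colors lowered by one. -/
def lowerPart (P : Finset (ℕ × ℕ)) : Finset (ℕ × ℕ) :=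
  {p ∈ P | p.1 ≠ 0}.image (fun p => (p.1 - 1, p.2))

section Glue

variable {A : Finset ℕ} {P : Finset (ℕ × ℕ)}

lemma mem_glue {p : ℕ × ℕ} :
    p ∈ glue A P ↔ (p.1 = 0 ∧ p.2 ∈ A) ∨ ∃ q ∈ P, (q.1 + 1, q.2) = p := by
  rcases p with ⟨b, x⟩
  simp only [glue, mem_union, Finset.mem_image, Prod.mk.injEq]
  refine or_congr_left ⟨?_, ?_⟩
  · rintro ⟨y, hy, rfl, rfl⟩
    exact ⟨rfl, hy⟩
  · rintro ⟨rfl, hx⟩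
    exact ⟨x, hx, rfl, rfl⟩

lemma zero_mem_glue {x : ℕ} : (0, x) ∈ glue A P ↔ x ∈ A := by
  simp [mem_glue]

lemma succ_mem_glue {b x : ℕ} : (b + 1, x) ∈ glue A P ↔ (b, x) ∈ P := by
  simp [mem_glue]

lemma mem_topNorms {x : ℕ} : x ∈ topNorms P ↔ (0, x) ∈ P := by
  simp [topNorms]

lemma mem_lowerPart {b x : ℕ} : (b, x) ∈ lowerPart P ↔ (b + 1, x) ∈ P := by
  simp only [lowerPart, Finset.mem_image, mem_filter, Prod.mk.injEq]
  constructor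
  · rintro ⟨⟨b', x'⟩, ⟨hP, h0⟩, rfl, rfl⟩
    simp only at h0 ⊢
    rwa [Nat.sub_add_cancel (by omega)]
  · intro h
    exact ⟨_, ⟨h, by simp⟩, by simp, rfl⟩

lemma topNorms_glue : topNorms (glue A P) = A := by
  ext x
  rw [mem_topNorms, zero_mem_glue]

lemma lowerPart_glue : lowerPart (glue A P) = P := by
  ext ⟨b, x⟩
  rw [mem_lowerPart, succ_mem_glue]

lemma glue_topNorms_lowerPart : glue (topNorms P) (lowerPart P) = P := by
  ext ⟨b, x⟩
  cases b with
  | zero => rw [zero_mem_glue, mem_topNorms]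
  | succ b => rw [succ_mem_glue, mem_lowerPart]

lemma raise_injective : Function.Injective (fun p : ℕ × ℕ => (p.1 + 1, p.2)) := by
  rintro ⟨a, x⟩ ⟨b, y⟩ h
  simpa using h

lemma card_glue : #(glue A P) = #A + #P := by
  rw [glue, card_union_of_disjoint, card_image_of_injective _ (Prod.mk_right_injective 0),
    card_image_of_injective _ raise_injective]
  rw [disjoint_left]
  intro p hp hp'
  obtain ⟨x, -, rfl⟩ := mem_image.1 hp
  obtain ⟨q, -, hq⟩ := mem_image.1 hp'
  simp at hq

lemma image_snd_glue : (glue A P).image Prod.snd = A ∪ P.image Prod.snd := by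
  rw [glue, image_union, image_image, image_image]
  congr 1
  exact image_id

lemma isBallot_succ_glue {c : ℕ} {G : Finset ℕ} (hcard : 2 * (#A + #P) < #G) :
    IsBallot (c + 1) G (glue A P) ↔ A ⊆ G ∧ IsBallot c (G \ A) P := by
  have key : ∀ p : ℕ × ℕ,
      (#{q ∈ glue A P | ¬ Prec (p.1 + 1, p.2) q} <
        #{y ∈ G | y ∉ (glue A P).image Prod.snd ∧ Prec (c + 1, y) (p.1 + 1, p.2)} ↔
      #{q ∈ P | ¬ Prec p q} < #{y ∈ G \ A | y ∉ P.image Prod.snd ∧ Prec (c, y) p}) := by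
    intro p
    have hl : #{q ∈ glue A P | ¬ Prec (p.1 + 1, p.2) q} = #{q ∈ P | ¬ Prec p q} := by
      rw [← card_image_of_injective {q ∈ P | ¬ Prec p q} raise_injective]
      congr 1
      ext ⟨b, x⟩
      simp only [mem_filter, Finset.mem_image]
      cases b with
      | zero => simp [Prec]
      | succ b =>
        rw [succ_mem_glue]
        simp [Prec]
    have hr : {y ∈ G | y ∉ (glue A P).image Prod.snd ∧ Prec (c + 1, y) (p.1 + 1, p.2)} =
        {y ∈ G \ A | y ∉ P.image Prod.snd ∧ Prec (c, y) p} := by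
      ext y
      rw [image_snd_glue, mem_filter, mem_filter, mem_sdiff, mem_union, not_or]
      have : Prec (c + 1, y) (p.1 + 1, p.2) ↔ Prec (c, y) p := by simp [Prec]
      rw [this]
      tauto
    rw [hl, hr]
  constructor
  · rintro ⟨h1, h2, h3⟩
    refine ⟨fun x hx => (h1 _ (zero_mem_glue.2 hx)).2, ?_, ?_, ?_⟩
    · rintro ⟨b, x⟩ hp
      have h := h1 _ (succ_mem_glue.2 hp)
      refine ⟨by simpa using h.1, mem_sdiff.2 ⟨h.2, fun hA => ?_⟩⟩
      have := h2 (mem_coe.2 (succ_mem_glue.2 hp)) (mem_coe.2 (zero_mem_glue.2 hA)) rfl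
      simp at this
    · rintro ⟨b, x⟩ hp ⟨b', x'⟩ hp' hx
      have := h2 (mem_coe.2 (succ_mem_glue.2 hp)) (mem_coe.2 (succ_mem_glue.2 hp')) hx
      simpa using this
    · intro p hp
      exact (key p).1 (h3 _ (succ_mem_glue.2 hp))
  · rintro ⟨hA, h1, h2, h3⟩
    have hinj : Set.InjOn Prod.snd (glue A P : Set (ℕ × ℕ)) := by
      rintro ⟨b, x⟩ hp ⟨b', x'⟩ hp' hx
      rw [mem_coe] at hp hp'
      simp only at hx
      subst hx
      rcases b with _ | b <;> rcases b' with _ | b'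
      · rfl
      · rw [zero_mem_glue] at hp
        rw [succ_mem_glue] at hp'
        exact absurd hp (mem_sdiff.1 (h1 _ hp').2).2
      · rw [zero_mem_glue] at hp'
        rw [succ_mem_glue] at hp
        exact absurd hp' (mem_sdiff.1 (h1 _ hp).2).2
      · rw [succ_mem_glue] at hp hp'
        have := h2 hp hp' rfl
        simpa using this
    have hmem : ∀ p ∈ glue A P, p.1 ≤ c + 1 ∧ p.2 ∈ G := by
      rintro ⟨b, x⟩ hp
      cases b with
      | zero => exact ⟨by simp, hA (zero_mem_glue.1 hp)⟩
      | succ b =>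
        have := h1 _ (succ_mem_glue.1 hp)
        exact ⟨by simpa using this.1, (mem_sdiff.1 this.2).1⟩
    refine ⟨hmem, hinj, ?_⟩
    rintro ⟨b, x⟩ hp
    cases b with
    | succ b => exact (key (b, x)).2 (h3 _ (succ_mem_glue.1 hp))
    | zero =>
      have hle := card_filter_le (glue A P) fun q => ¬ Prec (0, x) q
      have hge : #(G \ (glue A P).image Prod.snd) ≤
          #{y ∈ G | y ∉ (glue A P).image Prod.snd ∧ Prec (c + 1, y) (0, x)} := by
        apply card_le_card
        intro y hy
        rw [mem_sdiff] at hy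
        exact mem_filter.2 ⟨hy.1, hy.2, Or.inl (by simp)⟩
      have hsub : (glue A P).image Prod.snd ⊆ G := by
        intro y hy
        obtain ⟨p, hp, rfl⟩ := mem_image.1 hy
        exact (hmem p hp).2
      rw [card_sdiff_of_subset hsub, card_image_of_injOn hinj, card_glue] at hge
      rw [card_glue] at hle
      omega

end Glue

lemma card_ballotSets_succ {c d : ℕ} {G : Finset ℕ} (hd : 2 * d < #G) :
    #(ballotSets (c + 1) G d) =
      ∑ i ∈ range (d + 1), ∑ A ∈ powersetCard i G, #(ballotSets c (G \ A) (d - i)) := by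
  have hfiber : ∀ i ∈ range (d + 1), ∀ A ∈ powersetCard i G,
      #{P ∈ ballotSets (c + 1) G d | topNorms P = A} = #(ballotSets c (G \ A) (d - i)) := by
    intro i hi A hA
    rw [mem_range] at hi
    rw [mem_powersetCard] at hA
    rw [← card_image_of_injective (ballotSets c (G \ A) (d - i)) (f := glue A)]
    · congr 1
      ext P
      rw [mem_filter, mem_image, mem_ballotSets]
      constructor
      · rintro ⟨⟨hP, hPd⟩, rfl⟩
        rw [← glue_topNorms_lowerPart (P := P), card_glue] at hPd
        rw [← glue_topNorms_lowerPart (P := P), isBallot_succ_glue (by omega)] at hP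
        exact ⟨lowerPart P, mem_ballotSets.2 ⟨hP.2, by omega⟩, glue_topNorms_lowerPart⟩
      · rintro ⟨P, hP, rfl⟩
        rw [mem_ballotSets] at hP
        rw [isBallot_succ_glue (by omega), card_glue, topNorms_glue]
        exact ⟨⟨⟨hA.1, hP.1⟩, by omega⟩, rfl⟩
    · intro P Q h
      rw [← lowerPart_glue (A := A) (P := P), h, lowerPart_glue]
  rw [card_eq_sum_card_fiberwise (f := fun P => #(topNorms P)) (t := range (d + 1))]
  · refine sum_congr rfl fun i hi => ?_
    rw [card_eq_sum_card_fiberwise (f := topNorms) (t := powersetCard i G)]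
    · refine sum_congr rfl fun A hA => ?_
      rw [← hfiber i hi A hA, filter_filter]
      congr 1
      refine filter_congr fun P _ => ?_
      rw [and_iff_right_iff_imp]
      rintro rfl
      exact (mem_powersetCard.1 hA).2
    · intro P hP
      rw [mem_coe, mem_filter, mem_ballotSets] at hP
      refine mem_coe.2 (mem_powersetCard.2 ⟨fun x hx => ?_, hP.2⟩)
      exact (hP.1.1.1 _ (mem_topNorms.1 hx)).2
  · intro P hP
    rw [mem_coe, mem_ballotSets] at hP
    have := card_glue (A := topNorms P) (P := lowerPart P)
    rw [glue_topNorms_lowerPart] at this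
    simp only [coe_range, Set.mem_Iio]
    omega

/-- For small `d`, the number of ballot sets depends only on the size of the ground set. -/
lemma card_ballotSets_congr (c : ℕ) : ∀ {d : ℕ} {G H : Finset ℕ}, #G = #H → 2 * d < #G →
    #(ballotSets c G d) = #(ballotSets c H d) := by
  induction c with
  | zero =>
    intro d G H hGH hd
    rw [card_ballotSets_zero G d (card_pos.1 (by omega)) (by omega),
      card_ballotSets_zero H d (card_pos.1 (by omega)) (by omega), hGH]
  | succ c ih =>
    intro d G H hGH hd
    rw [card_ballotSets_succ hd, card_ballotSets_succ (hGH ▸ hd)]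
    refine sum_congr rfl fun i hi => ?_
    rw [mem_range] at hi
    have hsize : ∀ {K : Finset ℕ}, ∀ A ∈ powersetCard i K, #(K \ A) = #K - i := by
      intro K A hA
      rw [mem_powersetCard] at hA
      rw [card_sdiff_of_subset hA.1, hA.2]
    have hconst : ∀ {K : Finset ℕ}, #K = #G → ∀ A ∈ powersetCard i K,
        #(ballotSets c (K \ A) (d - i)) = #(ballotSets c (range (#G - i)) (d - i)) := by
      intro K hK A hA
      have := hsize A hA
      exact ih (by rw [this, hK, card_range]) (by omega)
    rw [sum_congr rfl (hconst rfl), sum_congr rfl (hconst hGH.symm), sum_const, sum_const,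
      card_powersetCard, card_powersetCard, hGH]

/-- The recursion `𝔭_{m,n}(d) = Σ_{i=0}^{d} C(n,i) 𝔭_{m-1,n-i}(d-i)`, together with
`𝔭_{1,n}(d) = C(n-1,d)` and `𝔭_{m,n}(0) = 1`. -/
theorem APS_card_recursion (m n d : ℕ) (hm : 2 ≤ m) (hn : 1 ≤ n)
    (hd : d ≤ (n - 1) / 2) :
    (APS m n d).ncard =
        ∑ i ∈ Finset.range (d + 1), Nat.choose n i * (APS (m - 1) (n - i) (d - i)).ncard ∧
      (∀ n' d' : ℕ, 1 ≤ n' → d' ≤ (n' - 1) / 2 →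
        (APS 1 n' d').ncard = Nat.choose (n' - 1) d') ∧
      (∀ m' n' : ℕ, 1 ≤ m' → 1 ≤ n' → (APS m' n' 0).ncard = 1) := by
  obtain ⟨c, rfl⟩ : ∃ c, m = c + 2 := ⟨m - 2, by omega⟩
  refine ⟨?_, ?_, ?_⟩
  · rw [APS_eq_ballotSets hn, Set.ncard_coe_finset,
      card_ballotSets_succ (by rw [Nat.card_Icc]; omega)]
    refine sum_congr rfl fun i hi => ?_
    rw [mem_range] at hi
    rw [show c + 2 - 1 = c + 1 by omega, APS_eq_ballotSets (by omega), Set.ncard_coe_finset]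
    rw [sum_congr rfl (g := fun _ => #(ballotSets c (Icc 1 (n - i)) (d - i))), sum_const,
      card_powersetCard, Nat.card_Icc, Nat.add_sub_cancel, smul_eq_mul]
    intro A hA
    rw [mem_powersetCard] at hA
    have hcard : #(Icc 1 n \ A) = n - i := by
      rw [card_sdiff_of_subset hA.1, hA.2, Nat.card_Icc, Nat.add_sub_cancel]
    exact card_ballotSets_congr c (by rw [hcard, Nat.card_Icc, Nat.add_sub_cancel]) (by omega)
  · intro n' d' hn' hd'
    have := card_ballotSets_zero (Icc 1 n') d' ⟨1, by simpa using hn'⟩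
      (by rw [Nat.card_Icc]; omega)
    rw [show (1 : ℕ) = 0 + 1 from rfl, APS_eq_ballotSets hn', Set.ncard_coe_finset, this,
      Nat.card_Icc, Nat.add_sub_cancel]
  · intro m' n' hm' hn'
    obtain ⟨c', rfl⟩ : ∃ c', m' = c' + 1 := ⟨m' - 1, by omega⟩
    rw [APS_eq_ballotSets hn', Set.ncard_coe_finset, ballotSets_zero, card_singleton]
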